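/- Let $X^1,\dots,X^n$ ($n\ge 2$) be continuous real-valued processes indexed by $t\in[0,1]$ on a probability space $(\Omega,\mathcal F,P)$, extended to $t\in\mathbb R$ by $X^k_t:=X^k_{(t\vee 0)\wedge 1}$. For $\varepsilon>0$ and $t\in[0,1]$ put $$[X^1,\dots,X^n]_\varepsilon(t)=\frac1\varepsilon\int_0^t\prod_{k=1}^n\bigl(X^k_{s+\varepsilon}-X^k_s\bigr)\,ds,\qquad \|[X^1,\dots,X^n]\|_\varepsilon=\frac1\varepsilon\int_0^1\prod_{k=1}^n\bigl|X^k_{s+\varepsilon}-X^k_s\bigr|\,ds .$$ Suppose that the $n$-covariation of $(X^1,\dots,X^n)$ exists, i.e. there is a real-valued process $A=(A_t)_{t\in[0,1]}$ such that $\sup_{t\in[0,1]}\bigl|[X^1,\dots,X^n]_\varepsilon(t)-A_t\bigr|\to 0$ in probability as $\varepsilon\to0^+$ (the supremum being taken in $[0,\infty]$), and that every sequence of positive reals $\varepsilon_j\to 0$ admits a subsequence $(\bar\varepsilon_j)$ such that $\sup_j\|[X^1,\dots,X^n]\|_{\bar\varepsilon_j}<+\infty$ almost surely. Then almost surely the path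 $t\mapsto A_t$ has bounded variation on $[0,1]$. -/

import Mathlib

open MeasureTheory Filter Set
open scoped Topology ENNReal

/-- The path `t ↦ X_t(ω)` of a process indexed by `[0,1]`, extended to all real times by
`X_t := X_{(t ∨ 0) ∧ 1}`. -/
noncomputable def extPath {Ω : Type*} (X : Icc (0 : ℝ) 1 → Ω → ℝ) (ω : Ω) (t : ℝ) : ℝ :=
  X (projIcc 0 1 zero_le_one t) ω

/-- The family `Z ε` converges ucp to `A` as `ε → 0⁺`: `sup_{t ∈ [0,1]} |Z ε t - A t| → 0` in
probability. The supremum is taken in `[0, ∞]`, so it is `∞` when the difference is unbounded. -/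
def UCP {Ω : Type*} [MeasurableSpace Ω] (P : Measure Ω)
    (Z : ℝ → Icc (0 : ℝ) 1 → Ω → ℝ) (A : Icc (0 : ℝ) 1 → Ω → ℝ) : Prop :=
  ∀ δ : ℝ, 0 < δ →
    Tendsto (fun ε : ℝ => P {ω | ENNReal.ofReal δ ≤
        ⨆ t : Icc (0 : ℝ) 1, ENNReal.ofReal |Z ε t ω - A t ω|})
      (𝓝[>] 0) (𝓝 0)

/-- `[X¹,…,Xⁿ]_ε(t) = (1/ε) ∫₀ᵗ ∏ₖ (Xᵏ_{s+ε} - Xᵏ_s) ds`. -/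
noncomputable def covApprox {Ω : Type*} {n : ℕ} (X : Fin n → Icc (0 : ℝ) 1 → Ω → ℝ)
    (ε : ℝ) (t : Icc (0 : ℝ) 1) (ω : Ω) : ℝ :=
  (1 / ε) * ∫ s in (0 : ℝ)..(t : ℝ), ∏ k, (extPath (X k) ω (s + ε) - extPath (X k) ω s)

/-- `‖[X¹,…,Xⁿ]‖_ε = (1/ε) ∫₀¹ ∏ₖ |Xᵏ_{s+ε} - Xᵏ_s| ds`. -/
noncomputable def covNorm {Ω : Type*} {n : ℕ} (X : Fin n → Icc (0 : ℝ) 1 → Ω → ℝ)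
    (ε : ℝ) (ω : Ω) : ℝ :=
  (1 / ε) * ∫ s in (0 : ℝ)..1, ∏ k, |extPath (X k) ω (s + ε) - extPath (X k) ω s|

/-- Every sequence `eⱼ → 0⁺` admits a subsequence along which
`sup_j ‖[X¹,…,Xⁿ]‖_{e_{φ j}} < ∞` almost surely. -/
def CovNormSubseqBounded {Ω : Type*} [MeasurableSpace Ω] (P : Measure Ω) {n : ℕ}
    (X : Fin n → Icc (0 : ℝ) 1 → Ω → ℝ) : Prop :=
  ∀ e : ℕ → ℝ, (∀ j, 0 < e j) → Tendsto e atTop (𝓝 0) →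
    ∃ φ : ℕ → ℕ, StrictMono φ ∧
      ∀ᵐ ω ∂P, BddAbove (range fun j => covNorm X (e (φ j)) ω)

/-- The variation of `f` is at most that of `g` when the increments of `f` are dominated by those
of `g`. -/
theorem eVariationOn_le_of_edist_le {α E F : Type*} [LinearOrder α] [PseudoEMetricSpace E]
    [PseudoEMetricSpace F] {f : α → E} {g : α → F} {s : Set α}
    (h : ∀ x ∈ s, ∀ y ∈ s, x ≤ y → edist (f y) (f x) ≤ edist (g y) (g x)) :
    eVariationOn f s ≤ eVariationOn g s := by
  refine iSup_le fun p => ?_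
  refine le_trans (Finset.sum_le_sum fun i _ => ?_)
    (eVariationOn.sum_le (f := g) p.2.2.1 p.2.2.2)
  exact h _ (p.2.2.2 i) _ (p.2.2.2 (i + 1)) (p.2.2.1 (Nat.le_succ i))

/-- A pointwise limit of functions of uniformly bounded variation has bounded variation. -/
theorem boundedVariationOn_of_tendsto {α E : Type*} [LinearOrder α] [PseudoEMetricSpace E]
    {s : Set α} {F : ℕ → α → E} {f : α → E}
    (hF : ∀ x ∈ s, Tendsto (fun j => F j x) atTop (𝓝 (f x))) {C : ℝ≥0∞} (hC : C ≠ ∞)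
    (h : ∀ j, eVariationOn (F j) s ≤ C) : BoundedVariationOn f s := by
  refine ne_top_of_le_ne_top hC (le_of_not_gt fun hlt => ?_)
  obtain ⟨j, hj⟩ := (eVariationOn.lowerSemicontinuous_aux hF hlt).exists
  exact (h j).not_gt hj

/-- The extension of a continuous path to all real times is continuous. -/
theorem continuous_extPath {Ω : Type*} {X : Icc (0 : ℝ) 1 → Ω → ℝ} {ω : Ω}
    (h : Continuous fun t => X t ω) : Continuous (extPath X ω) :=
  h.comp continuous_projIcc

/-- The variation of `[X¹,…,Xⁿ]_ε` on `[0,1]` is at most `‖[X¹,…,Xⁿ]‖_ε`. -/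
theorem eVariationOn_covApprox_le {Ω : Type*} {n : ℕ} {X : Fin n → Icc (0 : ℝ) 1 → Ω → ℝ}
    {ω : Ω} (hX : ∀ k, Continuous fun t => X k t ω) {ε : ℝ} (hε : 0 < ε) :
    eVariationOn (fun t => covApprox X ε t ω) univ ≤ ENNReal.ofReal (covNorm X ε ω) := by
  set p : ℝ → ℝ := fun s => ∏ k, (extPath (X k) ω (s + ε) - extPath (X k) ω s) with hp
  have hpc : Continuous p := continuous_finsetProd _ fun k _ =>
    ((continuous_extPath (hX k)).comp (continuous_id.add continuous_const)).sub
      (continuous_extPath (hX k))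
  have hε' : 0 ≤ 1 / ε := by positivity
  set G : Icc (0 : ℝ) 1 → ℝ := fun t => (1 / ε) * ∫ s in (0 : ℝ)..(t : ℝ), |p s| with hG
  have hGsub (x y : Icc (0 : ℝ) 1) :
      G y - G x = (1 / ε) * ∫ s in (x : ℝ)..(y : ℝ), |p s| := by
    simp only [hG]
    rw [← mul_sub, intervalIntegral.integral_interval_sub_left] <;>
      exact hpc.abs.intervalIntegrable _ _
  have hGmono : Monotone G := fun x y hxy => by
    rw [← sub_nonneg, hGsub]
    exact mul_nonneg hε' (intervalIntegral.integral_nonneg hxy fun _ _ => abs_nonneg _)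
  calc eVariationOn (fun t => covApprox X ε t ω) univ
      ≤ eVariationOn G univ := by
        refine eVariationOn_le_of_edist_le fun x _ y _ hxy => ?_
        rw [edist_dist, edist_dist, Real.dist_eq, Real.dist_eq]
        refine ENNReal.ofReal_le_ofReal ?_
        rw [abs_of_nonneg (sub_nonneg.2 (hGmono hxy)), hGsub]
        have : covApprox X ε y ω - covApprox X ε x ω
            = (1 / ε) * ∫ s in (x : ℝ)..(y : ℝ), p s := by
          simp only [covApprox]
          rw [← mul_sub, intervalIntegral.integral_interval_sub_left] <;>
            exact hpc.intervalIntegrable _ _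
        rw [this, abs_mul, abs_of_nonneg hε']
        exact mul_le_mul_of_nonneg_left
          (intervalIntegral.abs_integral_le_integral_abs hxy) hε'
    _ ≤ ENNReal.ofReal (G 1 - G 0) := by
        have := ((hGmono.monotoneOn univ).eVariationOn_eq (mem_univ 0) (mem_univ 1)).le
        rwa [show univ ∩ Icc (0 : Icc (0 : ℝ) 1) 1 = univ from
          eq_univ_of_forall fun t => ⟨mem_univ t, t.2.1, t.2.2⟩] at this
    _ = ENNReal.ofReal (covNorm X ε ω) := by
        rw [hGsub]
        simp [covNorm, hp, Finset.abs_prod]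

/-- A ucp convergent family has a sequence `eⱼ → 0⁺` along which almost surely
`Z (e j) t → A t` for every `t`. -/
theorem UCP.exists_seq_tendsto_ae {Ω : Type*} [MeasurableSpace Ω] {P : Measure Ω}
    {Z : ℝ → Icc (0 : ℝ) 1 → Ω → ℝ} {A : Icc (0 : ℝ) 1 → Ω → ℝ} (h : UCP P Z A) :
    ∃ e : ℕ → ℝ, (∀ j, 0 < e j) ∧ Tendsto e atTop (𝓝 0) ∧
      ∀ᵐ ω ∂P, ∀ t, Tendsto (fun j => Z (e j) t ω) atTop (𝓝 (A t ω)) := by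
  have hpow : Tendsto (fun j : ℕ => ((1 : ℝ) / 2) ^ j) atTop (𝓝 0) :=
    tendsto_pow_atTop_nhds_zero_of_lt_one (by norm_num) (by norm_num)
  have hex (j : ℕ) : ∃ ε : ℝ, (0 < ε ∧ ε < (1 / 2) ^ j) ∧
      P {ω | ENNReal.ofReal ((1 / 2) ^ j) ≤
        ⨆ t : Icc (0 : ℝ) 1, ENNReal.ofReal |Z ε t ω - A t ω|} < (1 / 2 : ℝ≥0∞) ^ j := by
    have hj : (0 : ℝ) < (1 / 2) ^ j := by positivity
    have h2 : (0 : ℝ≥0∞) < (1 / 2 : ℝ≥0∞) ^ j := ENNReal.pow_pos (by simp) j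
    exact ((eventually_mem_set.2 (Ioo_mem_nhdsGT hj)).and ((h _ hj).eventually_lt_const h2)).exists
  choose e he hP using hex
  refine ⟨e, fun j => (he j).1,
    squeeze_zero (fun j => (he j).1.le) (fun j => (he j).2.le) hpow, ?_⟩
  have hsum : ∑' j, P {ω | ENNReal.ofReal ((1 / 2) ^ j) ≤
      ⨆ t : Icc (0 : ℝ) 1, ENNReal.ofReal |Z (e j) t ω - A t ω|} ≠ ∞ := by
    refine ne_top_of_le_ne_top ?_ (ENNReal.tsum_le_tsum fun j => (hP j).le)
    rw [ENNReal.tsum_geometric]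
    simp
  filter_upwards [ae_eventually_notMem hsum] with ω hω t
  rw [tendsto_iff_dist_tendsto_zero]
  refine squeeze_zero' (.of_forall fun _ => dist_nonneg) (hω.mono fun j hj => ?_) hpow
  have hlt := (le_iSup (fun t => ENNReal.ofReal |Z (e j) t ω - A t ω|) t).trans_lt (not_le.1 hj)
  rw [Real.dist_eq]
  exact ((ENNReal.ofReal_lt_ofReal_iff (by positivity)).1 hlt).le

/-- If the `n`-covariation of the continuous processes `X¹,…,Xⁿ` exists, with ucp limit `A`, and
the boundedness condition on `‖[X¹,…,Xⁿ]‖_ε` along subsequences holds, then almost surely the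
path of `A` has bounded variation on `[0,1]`. -/
theorem covariation_boundedVariation
    {Ω : Type*} [MeasurableSpace Ω] (P : Measure Ω) [IsProbabilityMeasure P]
    (n : ℕ) (hn : 2 ≤ n) (X : Fin n → Icc (0 : ℝ) 1 → Ω → ℝ)
    (hX : ∀ k, ∀ᵐ ω ∂P, Continuous fun t => X k t ω)
    (A : Icc (0 : ℝ) 1 → Ω → ℝ)
    (hA : UCP P (covApprox X) A)
    (hbdd : CovNormSubseqBounded P X) :
    ∀ᵐ ω ∂P, BoundedVariationOn (fun t => A t ω) univ := by
  obtain ⟨e, he, he0, hlim⟩ := hA.exists_seq_tendsto_ae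
  obtain ⟨φ, hφ, hbd⟩ := hbdd e he he0
  filter_upwards [hlim, hbd, ae_all_iff.2 hX] with ω hω ⟨C, hC⟩ hc
  exact boundedVariationOn_of_tendsto (F := fun j t => covApprox X (e (φ j)) t ω)
    (fun t _ => (hω t).comp hφ.tendsto_atTop) (ENNReal.ofReal_ne_top (r := C))
    fun j => (eVariationOn_covApprox_le hc (he _)).trans
      (ENNReal.ofReal_le_ofReal (hC (mem_range_self j)))
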